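/- Let κ > 0, α₀ = 4π/κ, and β > α₀, and for α ∈ (α₀, β) let u_α be a solution of −Δu + e^{κu} = βδ₀ on ℤ² with u_α(x) = −(α/2π)ln|x| + O(1) as x → ∞. Then Σ_{x∈ℤ²} e^{κ u_α(x)} = β − α. -/

import Mathlib

noncomputable def latticeNorm (x : ℤ × ℤ) : ℝ :=
  Real.sqrt ((x.1 : ℝ) ^ 2 + (x.2 : ℝ) ^ 2)

def latticeLap (u : ℤ × ℤ → ℝ) (x : ℤ × ℤ) : ℝ :=
  (u (x.1 + 1, x.2) - u x) + (u (x.1 - 1, x.2) - u x) +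
    (u (x.1, x.2 + 1) - u x) + (u (x.1, x.2 - 1) - u x)

open Filter Topology

lemma abs_fst_le_latticeNorm (x : ℤ × ℤ) : |(x.1 : ℝ)| ≤ latticeNorm x :=
  Real.abs_le_sqrt (by nlinarith [sq_nonneg (x.2 : ℝ)])

lemma abs_snd_le_latticeNorm (x : ℤ × ℤ) : |(x.2 : ℝ)| ≤ latticeNorm x :=
  Real.abs_le_sqrt (by nlinarith [sq_nonneg (x.1 : ℝ)])

lemma norm_le_latticeNorm (x : ℤ × ℤ) : ‖x‖ ≤ latticeNorm x := by
  rw [Prod.norm_def, Int.norm_eq_abs, Int.norm_eq_abs]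
  exact max_le (abs_fst_le_latticeNorm x) (abs_snd_le_latticeNorm x)

lemma log_latticeNorm (x : ℤ × ℤ) :
    Real.log (latticeNorm x) = Real.log ((x.1 : ℝ) ^ 2 + (x.2 : ℝ) ^ 2) / 2 :=
  Real.log_sqrt (by positivity)

lemma tendsto_norm_cofinite_intProd :
    Tendsto (fun x : ℤ × ℤ => ‖x‖) cofinite atTop := by
  rw [← cocompact_eq_cofinite]
  exact tendsto_norm_cocompact_atTop

lemma tendsto_latticeNorm_cofinite : Tendsto latticeNorm cofinite atTop :=
  tendsto_atTop_mono norm_le_latticeNorm tendsto_norm_cofinite_intProd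

lemma summable_norm_rpow_intProd {p : ℝ} (hp : 2 < p) :
    Summable (fun x : ℤ × ℤ => ‖x‖ ^ (-p)) := by
  have h := EisensteinSeries.summable_one_div_norm_rpow hp
  rw [← (finTwoArrowEquiv ℤ).symm.summable_iff] at h
  refine h.congr fun x => ?_
  have : ‖(finTwoArrowEquiv ℤ).symm x‖ = ‖x‖ := by
    apply le_antisymm
    · rw [pi_norm_le_iff_of_nonneg (norm_nonneg _)]
      intro i
      fin_cases i
      · exact norm_fst_le x
      · exact norm_snd_le x
    · exact norm_prod_le_iff.2
        ⟨norm_le_pi_norm ((finTwoArrowEquiv ℤ).symm x) 0,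
          norm_le_pi_norm ((finTwoArrowEquiv ℤ).symm x) 1⟩
  simp only [Function.comp_apply, this]

/-- Summation by parts for the lattice Laplacian. -/
lemma tsum_latticeLap_mul {w φ : ℤ × ℤ → ℝ} (hφ : φ.support.Finite) :
    ∑' x, latticeLap w x * φ x = ∑' x, w x * latticeLap φ x := by
  have hsum : ∀ g : ℤ × ℤ → ℝ, Summable fun x => g x * φ x := fun g =>
    summable_of_hasFiniteSupport (hφ.subset fun x hx => right_ne_zero_of_mul hx)
  have shift : ∀ e : ℤ × ℤ, HasSum (fun x => w x * φ (x - e)) (∑' x, w (x + e) * φ x) := by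
    intro e
    rw [← (Equiv.addRight e).hasSum_iff]
    have := (hsum fun x => w (x + e)).hasSum
    convert this using 2 with x
    simp
  have base := (hsum w).hasSum
  have h1 := (hsum fun x => w (x + (1, 0))).hasSum
  have h2 := (hsum fun x => w (x + (-1, 0))).hasSum
  have h3 := (hsum fun x => w (x + (0, 1))).hasSum
  have h4 := (hsum fun x => w (x + (0, -1))).hasSum
  have hL := (((h1.add h2).add h3).add h4).sub (base.mul_left 4)
  have hR := (((shift (1, 0)).add (shift (-1, 0))).add
    (shift (0, 1))).add (shift (0, -1)) |>.sub (base.mul_left 4)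
  trans ∑' x, (w (x + (1, 0)) * φ x + w (x + (-1, 0)) * φ x + w (x + (0, 1)) * φ x +
      w (x + (0, -1)) * φ x - 4 * (w x * φ x))
  · refine tsum_congr fun x => ?_
    obtain ⟨a, b⟩ := x
    simp only [latticeLap, Prod.mk_add_mk, add_zero, ← sub_eq_add_neg]
    ring
  · rw [hL.tsum_eq, ← hR.tsum_eq]
    refine tsum_congr fun x => ?_
    obtain ⟨a, b⟩ := x
    simp only [latticeLap, Prod.mk_sub_mk, sub_zero, sub_neg_eq_add]
    ring

lemma abs_latticeLap_log_latticeNorm_le {x : ℤ × ℤ} (hx : 2 ≤ latticeNorm x) :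
    |latticeLap (fun y => Real.log (latticeNorm y)) x| ≤
      2 / ((x.1 : ℝ) ^ 2 + (x.2 : ℝ) ^ 2) ^ 2 := by
  obtain ⟨m, n⟩ := x
  have hs4 : (4 : ℝ) ≤ (m : ℝ) ^ 2 + (n : ℝ) ^ 2 := by
    have := (Real.le_sqrt' (by norm_num)).1 hx
    norm_num at this
    exact this
  simp only [latticeLap, log_latticeNorm]
  push_cast
  generalize (m : ℝ) = a at *
  generalize (n : ℝ) = b at *
  obtain ⟨s, hs⟩ : ∃ s, s = a ^ 2 + b ^ 2 := ⟨_, rfl⟩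
  rw [← hs] at hs4 ⊢
  have ha : a ^ 2 ≤ s := by nlinarith
  have hb : b ^ 2 ≤ s := by nlinarith
  have p1 : 0 < s + 1 - 2 * (-a) := by nlinarith [sq_nonneg (a + 2)]
  have p2 : 0 < s + 1 - 2 * a := by nlinarith [sq_nonneg (a - 2)]
  have p3 : 0 < s + 1 - 2 * (-b) := by nlinarith [sq_nonneg (b + 2)]
  have p4 : 0 < s + 1 - 2 * b := by nlinarith [sq_nonneg (b - 2)]
  have e1 : (a + 1) ^ 2 + b ^ 2 = s + 1 - 2 * (-a) := by rw [hs]; ring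
  have e2 : (a - 1) ^ 2 + b ^ 2 = s + 1 - 2 * a := by rw [hs]; ring
  have e3 : a ^ 2 + (b + 1) ^ 2 = s + 1 - 2 * (-b) := by rw [hs]; ring
  have e4 : a ^ 2 + (b - 1) ^ 2 = s + 1 - 2 * b := by rw [hs]; ring
  rw [e1, e2, e3, e4]
  have hs0 : 0 < s := by linarith
  obtain ⟨t, ht⟩ : ∃ t, t = ((s + 1 - 2 * (-a)) * (s + 1 - 2 * a) * (s + 1 - 2 * (-b)) *
    (s + 1 - 2 * b)) / s ^ 4 := ⟨_, rfl⟩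
  have hlog : Real.log t = Real.log (s + 1 - 2 * (-a)) + Real.log (s + 1 - 2 * a) +
      Real.log (s + 1 - 2 * (-b)) + Real.log (s + 1 - 2 * b) - 4 * Real.log s := by
    rw [ht, Real.log_div (by positivity) (by positivity), Real.log_mul (by positivity) p4.ne',
      Real.log_mul (by positivity) p3.ne', Real.log_mul p1.ne' p2.ne', Real.log_pow]
    norm_num
  have hts : t - 1 = (1 - 2 * s ^ 2 + 16 * (a * b) ^ 2) / s ^ 4 := by
    rw [ht, eq_div_iff (by positivity), sub_mul, div_mul_cancel₀ _ (by positivity), hs]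
    ring
  have hab : 16 * (a * b) ^ 2 ≤ 4 * s ^ 2 := by rw [hs]; nlinarith [sq_nonneg (a ^ 2 - b ^ 2)]
  have hupper : t - 1 ≤ 4 / s ^ 2 := by
    rw [hts, div_le_div_iff₀ (by positivity) (by positivity)]
    have : 1 - 2 * s ^ 2 + 16 * (a * b) ^ 2 ≤ 4 * s ^ 2 := by nlinarith
    nlinarith [mul_le_mul_of_nonneg_right this (sq_nonneg s)]
  have hlower : -(2 / s ^ 2) ≤ t - 1 := by
    rw [hts, ← neg_div, div_le_div_iff₀ (by positivity) (by positivity)]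
    have : -2 * s ^ 2 ≤ 1 - 2 * s ^ 2 + 16 * (a * b) ^ 2 := by nlinarith [sq_nonneg (a * b)]
    nlinarith [mul_le_mul_of_nonneg_right this (sq_nonneg s)]
  have hsmall : 2 / s ^ 2 ≤ 1 / 2 := by
    rw [div_le_div_iff₀ (by positivity) (by norm_num)]; nlinarith
  have htpos : 1 / 2 ≤ t := by linarith
  have hl1 : Real.log t ≤ 4 / s ^ 2 :=
    (Real.log_le_sub_one_of_pos (by linarith)).trans hupper
  have hl2 : -(4 / s ^ 2) ≤ Real.log t := by
    refine le_trans ?_ (Real.one_sub_inv_le_log_of_pos (by linarith))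
    have : 1 - t⁻¹ = (t - 1) / t := by field_simp
    rw [this, le_div_iff₀ (by linarith)]
    have h4 : 4 / s ^ 2 = 2 * (2 / s ^ 2) := by ring
    have : 0 ≤ 2 / s ^ 2 := by positivity
    rw [h4]
    nlinarith
  have h2 : 2 / s ^ 2 = (4 / s ^ 2) / 2 := by ring
  rw [abs_le, h2]
  constructor <;> linarith

lemma summable_latticeLap_log_latticeNorm :
    Summable (latticeLap fun y => Real.log (latticeNorm y)) := by
  refine Summable.of_norm_bounded_eventually
    ((summable_norm_rpow_intProd (p := 4) (by norm_num)).mul_left 2) ?_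
  filter_upwards [tendsto_latticeNorm_cofinite.eventually_ge_atTop 2,
    tendsto_norm_cofinite_intProd.eventually_ge_atTop 1] with x hx hx1
  refine (abs_latticeLap_log_latticeNorm_le hx).trans ?_
  have h0 : 0 < ‖x‖ := by linarith
  have hsq : ‖x‖ ^ 2 ≤ (x.1 : ℝ) ^ 2 + (x.2 : ℝ) ^ 2 := by
    have := pow_le_pow_left₀ h0.le (norm_le_latticeNorm x) 2
    rwa [latticeNorm, Real.sq_sqrt (by positivity)] at this
  have : ‖x‖ ^ (-4 : ℝ) = 1 / (‖x‖ ^ 2) ^ 2 := by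
    rw [Real.rpow_neg h0.le, one_div, ← pow_mul]
    norm_cast
  rw [this, ← mul_div_assoc, mul_one]
  gcongr

/-- The logarithmic cutoffs `(1 - log|x| / L)⁺` have lattice Laplacian of `ℓ¹` norm `O(1 / L)`,
so they detect the total mass of the Laplacian of a bounded function. -/
lemma tsum_latticeLap_eq_zero_of_bounded {w : ℤ × ℤ → ℝ} {C : ℝ} (hw : ∀ x, |w x| ≤ C)
    (hs : Summable (latticeLap w)) : ∑' x, latticeLap w x = 0 := by
  set G : ℤ × ℤ → ℝ := fun y => Real.log (latticeNorm y) with hG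
  have hGs : Summable fun x => |latticeLap G x| := summable_latticeLap_log_latticeNorm.abs
  set S := ∑' x, |latticeLap G x|
  let ψ : ℝ → ℤ × ℤ → ℝ := fun L x => max (L - G x) 0
  have hC : 0 ≤ C := (abs_nonneg _).trans (hw 0)
  have hG0 : ∀ x, 0 ≤ G x := by
    intro x
    rw [hG]
    simp only [log_latticeNorm]
    have : (x.1 : ℝ) ^ 2 + (x.2 : ℝ) ^ 2 = ((x.1 ^ 2 + x.2 ^ 2 : ℤ) : ℝ) := by push_cast; rfl
    rw [this]
    have := Real.log_intCast_nonneg (x.1 ^ 2 + x.2 ^ 2)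
    positivity
  have hsupp : ∀ L, (ψ L).support.Finite := by
    intro L
    have := (Real.tendsto_log_atTop.comp tendsto_latticeNorm_cofinite).eventually_ge_atTop L
    refine (eventually_cofinite.1 this).subset fun x hx h => hx ?_
    exact max_eq_right (sub_nonpos.2 h)
  have hlapsum : ∀ L, Summable (latticeLap (ψ L)) := by
    intro L
    have hf := hsupp L
    have key : ∀ e : ℤ × ℤ, Summable fun x => ψ L (x + e) := fun e =>
      (Equiv.addRight e).summable_iff.2 (summable_of_hasFiniteSupport hf)
    have h := ((((key (1, 0)).add (key (-1, 0))).add (key (0, 1))).add (key (0, -1))).sub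
      ((key 0).mul_left 4)
    refine h.congr fun x => ?_
    obtain ⟨a, b⟩ := x
    simp only [latticeLap, Prod.mk_add_mk, add_zero, ← sub_eq_add_neg]
    ring
  have hneg : ∀ L x, |latticeLap (ψ L) x| ≤ latticeLap (ψ L) x + 2 * |latticeLap G x| := by
    intro L x
    have hlow : -|latticeLap G x| ≤ latticeLap (ψ L) x := by
      have hψ0 : ∀ y, 0 ≤ ψ L y := fun y => le_max_right _ _
      have hψ1 : ∀ y, L - G y ≤ ψ L y := fun y => le_max_left _ _
      rcases le_total (L - G x) 0 with h | h
      · have h0 : ψ L x = 0 := max_eq_right h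
        have := hψ0 (x.1 + 1, x.2)
        have := hψ0 (x.1 - 1, x.2)
        have := hψ0 (x.1, x.2 + 1)
        have := hψ0 (x.1, x.2 - 1)
        have := abs_nonneg (latticeLap G x)
        simp only [latticeLap, h0] at *
        linarith
      · have h0 : ψ L x = L - G x := max_eq_left h
        have := hψ1 (x.1 + 1, x.2)
        have := hψ1 (x.1 - 1, x.2)
        have := hψ1 (x.1, x.2 + 1)
        have := hψ1 (x.1, x.2 - 1)
        have := le_abs_self (latticeLap G x)
        refine (neg_le_neg this).trans ?_
        simp only [latticeLap, h0]
        linarith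
    rw [abs_le]
    constructor <;> linarith [abs_nonneg (latticeLap G x)]
  have hzero : ∀ L, ∑' x, latticeLap (ψ L) x = 0 := by
    intro L
    have := tsum_latticeLap_mul (w := fun _ => 1) (hsupp L)
    simpa [latticeLap] using this.symm
  have habs : ∀ L, ∑' x, |latticeLap (ψ L) x| ≤ 2 * S := by
    intro L
    refine ((hlapsum L).abs.tsum_le_tsum (hneg L) ((hlapsum L).add (hGs.mul_left 2))).trans ?_
    rw [(hlapsum L).tsum_add (hGs.mul_left 2), hzero, tsum_mul_left, zero_add]
  have hbound : ∀ L, |∑' x, latticeLap w x * ψ L x| ≤ C * (2 * S) := by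
    intro L
    rw [tsum_latticeLap_mul (hsupp L)]
    have hle : ∀ x, ‖w x * latticeLap (ψ L) x‖ ≤ C * |latticeLap (ψ L) x| := fun x => by
      rw [norm_mul]
      exact mul_le_mul_of_nonneg_right (hw x) (abs_nonneg _)
    refine (tsum_of_norm_bounded ((hlapsum L).abs.mul_left C).hasSum hle).trans ?_
    rw [tsum_mul_left]
    exact mul_le_mul_of_nonneg_left (habs L) hC
  have hlim : Tendsto (fun L : ℝ => ∑' x, latticeLap w x * (ψ L x / L)) atTop
      (𝓝 (∑' x, latticeLap w x)) := by
    refine tendsto_tsum_of_dominated_convergence hs.norm (fun x => ?_) ?_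
    · have h1 : Tendsto (fun L : ℝ => 1 - G x / L) atTop (𝓝 1) := by
        simpa using (tendsto_const_nhds (x := (1 : ℝ))).sub
          (tendsto_const_nhds.div_atTop tendsto_id : Tendsto (fun L : ℝ => G x / L) atTop (𝓝 0))
      have h2 : Tendsto (fun L : ℝ => ψ L x / L) atTop (𝓝 1) := by
        refine h1.congr' ?_
        filter_upwards [eventually_ge_atTop (G x), eventually_gt_atTop 0] with L hL hL0
        have : ψ L x = L - G x := max_eq_left (sub_nonneg.2 hL)
        rw [this, sub_div, div_self hL0.ne']
      simpa using h2.const_mul (latticeLap w x)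
    · filter_upwards [eventually_gt_atTop 0] with L hL x
      rw [norm_mul]
      refine mul_le_of_le_one_right (norm_nonneg _) ?_
      rw [Real.norm_eq_abs, abs_of_nonneg (div_nonneg (le_max_right _ _) hL.le), div_le_one hL]
      exact max_le (by linarith [hG0 x]) hL.le
  have hlim0 : Tendsto (fun L : ℝ => ∑' x, latticeLap w x * (ψ L x / L)) atTop (𝓝 0) := by
    refine squeeze_zero_norm' (a := fun L => C * (2 * S) / L) ?_
      (tendsto_const_nhds.div_atTop tendsto_id)
    filter_upwards [eventually_gt_atTop 0] with L hL
    simp only [← mul_div_assoc, tsum_div_const]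
    rw [norm_div, Real.norm_eq_abs, Real.norm_eq_abs, abs_of_pos hL]
    exact div_le_div_of_nonneg_right (hbound L) hL.le
  exact tendsto_nhds_unique hlim hlim0

lemma sum_Icc_second_difference (g : ℤ → ℝ) (N : ℕ) :
    ∑ k ∈ Finset.Icc (-(N : ℤ)) N, ((g (k + 1) - g k) + (g (k - 1) - g k)) =
      (g (N + 1) - g N) + (g (-N - 1) - g (-N)) := by
  induction N with
  | zero => simp
  | succ N ih =>
    have : Finset.Icc (-((N + 1 : ℕ) : ℤ)) ((N + 1 : ℕ) : ℤ) =
        insert (-(N : ℤ) - 1) (insert ((N : ℤ) + 1) (Finset.Icc (-(N : ℤ)) N)) := by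
      ext k
      simp only [Finset.mem_Icc, Finset.mem_insert]
      omega
    rw [this, Finset.sum_insert (by simp; omega), Finset.sum_insert (by simp), ih]
    push_cast
    have e1 : -(N : ℤ) - 1 + 1 = -N := by ring
    have e2 : (N : ℤ) + 1 - 1 = N := by ring
    have e3 : -((N : ℤ) + 1) = -N - 1 := by ring
    rw [e1, e2, e3]
    ring

lemma sum_Icc_even (g : ℤ → ℝ) (hg : ∀ k, g (-k) = g k) (N : ℕ) :
    ∑ k ∈ Finset.Icc (-(N : ℤ)) N, g k = g 0 + 2 * ∑ k ∈ Finset.range N, g (k + 1) := by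
  induction N with
  | zero => simp
  | succ N ih =>
    have : Finset.Icc (-((N + 1 : ℕ) : ℤ)) ((N + 1 : ℕ) : ℤ) =
        insert (-((N : ℤ) + 1)) (insert ((N : ℤ) + 1) (Finset.Icc (-(N : ℤ)) N)) := by
      ext k
      simp only [Finset.mem_Icc, Finset.mem_insert]
      omega
    rw [this, Finset.sum_insert (by simp; omega), Finset.sum_insert (by simp), ih,
      Finset.sum_range_succ, hg]
    ring

lemma sum_square_latticeLap (G : ℤ × ℤ → ℝ) (hswap : ∀ a b, G (a, b) = G (b, a))
    (hneg : ∀ a b, G (-a, b) = G (a, b)) (N : ℕ) :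
    ∑ x ∈ Finset.Icc (-(N : ℤ)) N ×ˢ Finset.Icc (-(N : ℤ)) N, latticeLap G x =
      4 * ∑ k ∈ Finset.Icc (-(N : ℤ)) N, (G ((N : ℤ) + 1, k) - G (N, k)) := by
  have hrow : ∀ b : ℤ, ∑ a ∈ Finset.Icc (-(N : ℤ)) N,
      ((G (a + 1, b) - G (a, b)) + (G (a - 1, b) - G (a, b))) =
        2 * (G ((N : ℤ) + 1, b) - G (N, b)) := by
    intro b
    rw [sum_Icc_second_difference (fun a => G (a, b))]
    have : -(N : ℤ) - 1 = -(N + 1) := by ring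
    rw [this, hneg, hneg]
    ring
  have hsplit : ∀ x : ℤ × ℤ, latticeLap G x =
      ((G (x.1 + 1, x.2) - G (x.1, x.2)) + (G (x.1 - 1, x.2) - G (x.1, x.2))) +
      ((G (x.2 + 1, x.1) - G (x.2, x.1)) + (G (x.2 - 1, x.1) - G (x.2, x.1))) := by
    rintro ⟨a, b⟩
    simp only [latticeLap]
    rw [hswap (b + 1) a, hswap (b - 1) a, hswap b a]
    ring
  rw [Finset.sum_congr rfl fun x _ => hsplit x, Finset.sum_add_distrib,
    Finset.sum_product_right, Finset.sum_product]
  simp only [hrow]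
  rw [← Finset.mul_sum]
  ring

lemma arctan_sub_arctan_bounds {x y : ℝ} (hx : 0 ≤ x) (hxy : x < y) :
    (y - x) / (1 + y ^ 2) ≤ Real.arctan y - Real.arctan x ∧
      Real.arctan y - Real.arctan x ≤ (y - x) / (1 + x ^ 2) := by
  obtain ⟨c, ⟨hxc, hcy⟩, hc⟩ := exists_hasDerivAt_eq_slope Real.arctan (fun t => 1 / (1 + t ^ 2))
    hxy Real.continuous_arctan.continuousOn fun t _ => Real.hasDerivAt_arctan t
  have hd : 0 < y - x := sub_pos.2 hxy
  have : Real.arctan y - Real.arctan x = (y - x) / (1 + c ^ 2) := by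
    rw [eq_div_iff hd.ne'] at hc
    rw [← hc]
    ring
  have hc0 : 0 ≤ c := hx.trans hxc.le
  rw [this]
  constructor <;> gcongr

lemma sum_div_sq_add_sq_le {M : ℝ} (hM : 0 < M) (n : ℕ) :
    ∑ k ∈ Finset.range n, M / (M ^ 2 + ((k : ℝ) + 1) ^ 2) ≤ Real.arctan (n / M) := by
  have h : ∀ k ∈ Finset.range n, M / (M ^ 2 + ((k : ℝ) + 1) ^ 2) ≤
      Real.arctan (((k + 1 : ℕ) : ℝ) / M) - Real.arctan ((k : ℝ) / M) := by
    intro k _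
    refine le_trans (le_of_eq ?_) (arctan_sub_arctan_bounds (by positivity)
      (div_lt_div_of_pos_right (by push_cast; linarith) hM)).1
    push_cast
    field_simp
    ring
  refine (Finset.sum_le_sum h).trans (le_of_eq ?_)
  rw [Finset.sum_range_sub (fun k : ℕ => Real.arctan ((k : ℝ) / M))]
  simp

lemma arctan_le_sum_div_sq_add_sq {M : ℝ} (hM : 0 < M) (n : ℕ) :
    Real.arctan (n / M) ≤ ∑ k ∈ Finset.range n, M / (M ^ 2 + (k : ℝ) ^ 2) := by
  have h : ∀ k ∈ Finset.range n,
      Real.arctan (((k + 1 : ℕ) : ℝ) / M) - Real.arctan ((k : ℝ) / M) ≤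
        M / (M ^ 2 + (k : ℝ) ^ 2) := by
    intro k _
    refine (arctan_sub_arctan_bounds (by positivity)
      (div_lt_div_of_pos_right (by push_cast; linarith) hM)).2.trans (le_of_eq ?_)
    push_cast
    field_simp
    ring
  refine le_trans (le_of_eq ?_) (Finset.sum_le_sum h)
  rw [Finset.sum_range_sub (fun k : ℕ => Real.arctan ((k : ℝ) / M))]
  simp

lemma log_sub_log_bounds {p q : ℝ} (hp : 0 < p) (hq : 0 < q) :
    (q - p) / q ≤ Real.log q - Real.log p ∧ Real.log q - Real.log p ≤ (q - p) / p := by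
  rw [← Real.log_div hq.ne' hp.ne']
  constructor
  · refine le_trans (le_of_eq ?_) (Real.one_sub_inv_le_log_of_pos (div_pos hq hp))
    field_simp
  · refine (Real.log_le_sub_one_of_pos (div_pos hq hp)).trans (le_of_eq ?_)
    field_simp

lemma sum_square_latticeLap_log_bounds {N : ℕ} (hN : 0 < N) :
    (2 * N + 1) / (N + 1) * Real.pi - 2 * ((2 * N + 1) / (N : ℝ) ^ 2) ≤
        ∑ x ∈ Finset.Icc (-(N : ℤ)) N ×ˢ Finset.Icc (-(N : ℤ)) N,
          latticeLap (fun y => Real.log (latticeNorm y)) x ∧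
      ∑ x ∈ Finset.Icc (-(N : ℤ)) N ×ˢ Finset.Icc (-(N : ℤ)) N,
          latticeLap (fun y => Real.log (latticeNorm y)) x ≤
        (2 * N + 1) / N * Real.pi + 2 * ((2 * N + 1) / (N : ℝ) ^ 2) := by
  have hN' : (0 : ℝ) < N := Nat.cast_pos.2 hN
  let t : ℝ → ℝ := fun k => Real.log (((N : ℝ) + 1) ^ 2 + k ^ 2) - Real.log ((N : ℝ) ^ 2 + k ^ 2)
  have ht : ∀ k, (2 * N + 1) / (N + 1) * ((N + 1) / (((N : ℝ) + 1) ^ 2 + k ^ 2)) ≤ t k ∧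
      t k ≤ (2 * N + 1) / N * (N / ((N : ℝ) ^ 2 + k ^ 2)) := by
    intro k
    have hp : 0 < (N : ℝ) ^ 2 + k ^ 2 := by positivity
    have hq : 0 < ((N : ℝ) + 1) ^ 2 + k ^ 2 := by positivity
    have h := log_sub_log_bounds hp hq
    have hd : ((N : ℝ) + 1) ^ 2 + k ^ 2 - ((N : ℝ) ^ 2 + k ^ 2) = 2 * N + 1 := by ring
    rw [hd] at h
    refine ⟨le_trans (le_of_eq ?_) h.1, h.2.trans (le_of_eq ?_)⟩ <;> field_simp
  have hsum : ∑ x ∈ Finset.Icc (-(N : ℤ)) N ×ˢ Finset.Icc (-(N : ℤ)) N,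
      latticeLap (fun y => Real.log (latticeNorm y)) x =
        2 * t 0 + 4 * ∑ k ∈ Finset.range N, t (k + 1) := by
    rw [sum_square_latticeLap _ (fun a b => by simp only [log_latticeNorm, add_comm])
      (fun a b => by simp [log_latticeNorm]), sum_Icc_even _ (fun k => by simp [log_latticeNorm])]
    have h : ∀ k : ℤ, Real.log (latticeNorm ((N : ℤ) + 1, k)) - Real.log (latticeNorm ((N : ℤ), k))
        = t k / 2 := by
      intro k
      simp only [log_latticeNorm, t]
      push_cast
      ring
    simp only [h]
    push_cast
    rw [← Finset.sum_div]
    ring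
  have hupper : ∑ k ∈ Finset.range N, t (k + 1) ≤ (2 * N + 1) / N * (Real.pi / 4) := by
    refine (Finset.sum_le_sum fun (k : ℕ) _ => (ht ((k : ℝ) + 1)).2).trans ?_
    rw [← Finset.mul_sum]
    have := sum_div_sq_add_sq_le hN' N
    rw [div_self hN'.ne', Real.arctan_one] at this
    exact mul_le_mul_of_nonneg_left this (by positivity)
  have hlower : (2 * N + 1) / (N + 1) * (Real.pi / 4) ≤ ∑ k ∈ Finset.range (N + 1), t k := by
    refine le_trans ?_ (Finset.sum_le_sum fun k _ => (ht k).1)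
    rw [← Finset.mul_sum]
    have hN1 : (0 : ℝ) < N + 1 := by positivity
    have := arctan_le_sum_div_sq_add_sq hN1 (N + 1)
    push_cast at this
    rw [div_self hN1.ne', Real.arctan_one] at this
    exact mul_le_mul_of_nonneg_left this (by positivity)
  rw [Finset.sum_range_succ'] at hlower
  push_cast at hlower
  have h0 : t 0 ≤ (2 * N + 1) / (N : ℝ) ^ 2 := by
    refine (ht 0).2.trans (le_of_eq ?_)
    field_simp
    ring
  rw [hsum]
  constructor <;> linarith

lemma hasSum_latticeLap_log_latticeNorm :
    HasSum (latticeLap fun y => Real.log (latticeNorm y)) (2 * Real.pi) := by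
  have hs := summable_latticeLap_log_latticeNorm
  suffices h : Tendsto (fun N : ℕ => ∑ x ∈ Finset.Icc (-(N : ℤ)) N ×ˢ Finset.Icc (-(N : ℤ)) N,
      latticeLap (fun y => Real.log (latticeNorm y)) x) atTop (𝓝 (2 * Real.pi)) by
    have hsq : Tendsto (fun N : ℕ => Finset.Icc (-(N : ℤ)) N ×ˢ Finset.Icc (-(N : ℤ)) N)
        atTop atTop := by
      refine tendsto_atTop_finset_of_monotone (fun m n hmn => ?_) fun x => ?_
      · have : (m : ℤ) ≤ n := Int.ofNat_le.2 hmn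
        exact Finset.product_subset_product (Finset.Icc_subset_Icc (by omega) this)
          (Finset.Icc_subset_Icc (by omega) this)
      · refine ⟨x.1.natAbs + x.2.natAbs, ?_⟩
        simp only [Finset.mem_product, Finset.mem_Icc]
        omega
    have := tendsto_nhds_unique h (hs.hasSum.comp hsq)
    rw [this]
    exact hs.hasSum
  have hinv : Tendsto (fun N : ℕ => ((N : ℝ))⁻¹) atTop (𝓝 0) := tendsto_inv_atTop_nhds_zero_nat
  have hinv1 : Tendsto (fun N : ℕ => ((N : ℝ) + 1)⁻¹) atTop (𝓝 0) := by
    simpa using tendsto_one_div_add_atTop_nhds_zero_nat (𝕜 := ℝ)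
  have herr : Tendsto (fun N : ℕ => 2 * (2 * (N : ℝ)⁻¹ + (N : ℝ)⁻¹ ^ 2)) atTop (𝓝 0) := by
    simpa using ((hinv.const_mul 2).add (hinv.pow 2)).const_mul 2
  have hlo : Tendsto (fun N : ℕ => (2 - ((N : ℝ) + 1)⁻¹) * Real.pi -
      2 * (2 * (N : ℝ)⁻¹ + (N : ℝ)⁻¹ ^ 2)) atTop (𝓝 (2 * Real.pi)) := by
    simpa using ((hinv1.const_sub 2).mul_const Real.pi).sub herr
  have hhi : Tendsto (fun N : ℕ => (2 + (N : ℝ)⁻¹) * Real.pi +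
      2 * (2 * (N : ℝ)⁻¹ + (N : ℝ)⁻¹ ^ 2)) atTop (𝓝 (2 * Real.pi)) := by
    simpa using ((hinv.const_add 2).mul_const Real.pi).add herr
  refine tendsto_of_tendsto_of_tendsto_of_le_of_le' hlo hhi ?_ ?_
  all_goals
    filter_upwards [eventually_gt_atTop 0] with N hN
    have hN' : (N : ℝ) ≠ 0 := Nat.cast_ne_zero.2 hN.ne'
    have hb := sum_square_latticeLap_log_bounds hN
    have e1 : (2 * (N : ℝ) + 1) / N ^ 2 = 2 * (N : ℝ)⁻¹ + (N : ℝ)⁻¹ ^ 2 := by field_simp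
    have e2 : (2 * (N : ℝ) + 1) / N = 2 + (N : ℝ)⁻¹ := by field_simp
    have e3 : (2 * (N : ℝ) + 1) / (N + 1) = 2 - ((N : ℝ) + 1)⁻¹ := by
      have : (N : ℝ) + 1 ≠ 0 := by positivity
      field_simp
      ring
    rw [e1, e2, e3] at hb
  · exact hb.1
  · exact hb.2

/-- Total mass identity: a solution of `-Δu + e^{κu} = βδ₀` on `ℤ²` with
`u(x) = -(α/2π)ln|x| + O(1)` and `α ∈ (4π/κ, β)` satisfies
`Σ_{x∈ℤ²} e^{κu(x)} = β - α`. -/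
theorem absorption_total_mass (κ α β : ℝ) (hκ : 0 < κ)
    (hα₁ : 4 * Real.pi / κ < α) (hα₂ : α < β)
    (u : ℤ × ℤ → ℝ)
    (heq : ∀ x : ℤ × ℤ,
      -latticeLap u x + Real.exp (κ * u x) = β * (if x = (0, 0) then 1 else 0))
    (hasymp : ∃ C R : ℝ, 0 < R ∧ ∀ x : ℤ × ℤ, R ≤ latticeNorm x →
      |u x + (α / (2 * Real.pi)) * Real.log (latticeNorm x)| ≤ C) :
    HasSum (fun x : ℤ × ℤ => Real.exp (κ * u x)) (β - α) := by
  obtain ⟨C, R, -, hC⟩ := hasymp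
  set G : ℤ × ℤ → ℝ := fun y => Real.log (latticeNorm y)
  set c := α / (2 * Real.pi) with hc
  have hpi := Real.pi_pos
  have hp : 2 < κ * c := by
    rw [div_lt_iff₀ hκ] at hα₁
    rw [hc, ← mul_div_assoc, lt_div_iff₀ (by positivity)]
    linarith
  have hev := tendsto_latticeNorm_cofinite.eventually_ge_atTop R
  have hexp : Summable fun x => Real.exp (κ * u x) := by
    refine Summable.of_norm_bounded_eventually
      ((summable_norm_rpow_intProd hp).mul_left (Real.exp (κ * C))) ?_
    filter_upwards [hev, tendsto_norm_cofinite_intProd.eventually_ge_atTop 1] with x hx hx1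
    have h0 : 0 < ‖x‖ := by linarith
    rw [Real.norm_eq_abs, Real.abs_exp, Real.rpow_def_of_pos h0, ← Real.exp_add, Real.exp_le_exp]
    have hu := (abs_le.1 (hC x hx)).2
    have hlog := Real.log_le_log h0 (norm_le_latticeNorm x)
    have := mul_le_mul_of_nonneg_left hu hκ.le
    have := mul_le_mul_of_nonneg_left hlog (by linarith : 0 ≤ κ * c)
    linarith
  have hlap : latticeLap (fun x => u x + c * G x) =
      fun x => (Real.exp (κ * u x) - β * (if x = (0, 0) then 1 else 0)) + c * latticeLap G x := by
    funext x
    rw [← heq x]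
    simp only [latticeLap]
    ring
  have hdelta : HasSum (fun x : ℤ × ℤ => β * (if x = (0, 0) then (1 : ℝ) else 0)) (β * 1) :=
    (hasSum_ite_eq _ _).mul_left β
  have hG : HasSum (fun x => c * latticeLap G x) α := by
    have := hasSum_latticeLap_log_latticeNorm.mul_left c
    rwa [hc, div_mul_cancel₀ α (by positivity)] at this
  have htotal := (hexp.hasSum.sub hdelta).add hG
  rw [← hlap] at htotal
  obtain ⟨B, hB⟩ : ∃ B, ∀ x, |u x + c * G x| ≤ B := by
    have hfin : {x | ¬ R ≤ latticeNorm x}.Finite := eventually_cofinite.1 hev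
    obtain ⟨D, hD⟩ := (hfin.image fun x => |u x + c * G x|).bddAbove
    refine ⟨max C D, fun x => ?_⟩
    by_cases hx : R ≤ latticeNorm x
    · exact (hC x hx).trans (le_max_left _ _)
    · exact (hD ⟨x, hx, rfl⟩).trans (le_max_right _ _)
  have hzero := tsum_latticeLap_eq_zero_of_bounded hB htotal.summable
  rw [htotal.tsum_eq] at hzero
  have : ∑' x, Real.exp (κ * u x) = β - α := by linarith
  rw [← this]
  exact hexp.hasSum
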